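/- Lower bound half of the variational principle for weighted entropy: sup_{μ∈M^G(X_1)} Σ_{i=1}^r w_i h_{μ_i}(X_i,G) ≤ h^a_top(G), where h^a_top(G) = P^a(0,G) is the a-weighted topological pressure of the zero function. -/

import Mathlib

open scoped BigOperators NNReal
open Filter

namespace WPP

variable (G : Type) [Group G]

/-- `B(F,K) = {g ∈ G : Kg ∩ F ≠ ∅ and Kg ∩ (G∖F) ≠ ∅}`. -/
def folnerB (F K : Finset G) : Set G :=
  {g : G | (∃ k ∈ K, k * g ∈ F) ∧ ∃ k ∈ K, k * g ∉ F}

/-- A Følner sequence of `G`. -/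
def IsFolner (F : ℕ → Finset G) : Prop :=
  (∀ n, (F n).Nonempty) ∧
    ∀ K : Finset G, K.Nonempty →
      Tendsto (fun n => ((folnerB G (F n) K).ncard : ℝ) / ((F n).card : ℝ)) atTop (nhds 0)

/-- A `G`-system: a compact metric space together with a continuous action of `G`
by homeomorphisms. -/
structure GSystem where
  carrier : Type
  [metric : MetricSpace carrier]
  [cpt : CompactSpace carrier]
  act : G → carrier → carrier
  one_act : ∀ x, act 1 x = x
  mul_act : ∀ g h x, act (g * h) x = act g (act h x)
  cont_act : ∀ g, Continuous (act g)

attribute [instance] GSystem.metric GSystem.cpt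

variable {G}

noncomputable instance (S : GSystem G) : MeasurableSpace S.carrier := borel S.carrier
instance (S : GSystem G) : BorelSpace S.carrier := ⟨rfl⟩

/-- A factor map between `G`-systems: a continuous equivariant surjection. -/
structure FactorMap (S T : GSystem G) where
  toFun : S.carrier → T.carrier
  cont : Continuous toFun
  surj : Function.Surjective toFun
  equiv : ∀ g x, toFun (S.act g x) = T.act g (toFun x)

/-- The dynamical (Bowen) metric `d_F(x,y) = max_{g∈F} d(gx,gy)`. -/
noncomputable def dynDist (S : GSystem G) (F : Finset G) (x y : S.carrier) : ℝ :=
  ((F.sup fun g => nndist (S.act g x) (S.act g y) : ℝ≥0) : ℝ)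

/-- `diam(U, d_F) < ε`. -/
def diamLT (S : GSystem G) (F : Finset G) (U : Set S.carrier) (ε : ℝ) : Prop :=
  ∀ x ∈ U, ∀ y ∈ U, dynDist S F x y < ε

/-- The Birkhoff-type sum `S_F f(x) = Σ_{g∈F} f(gx)`. -/
noncomputable def birk (S : GSystem G) (f : S.carrier → ℝ) (F : Finset G) (x : S.carrier) : ℝ :=
  ∑ g ∈ F, f (S.act g x)

variable (X : ℕ → GSystem G) (π : ∀ i, FactorMap (X i) (X (i + 1)))

/-- The recursively defined weighted quantities `P^a_{i+1}(Ω, f, F, ε)` (0-indexed: `wP … i`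
corresponds to the paper's `P^a_{i+1}`, and `a i` to the paper's `a_{i+1}`). -/
noncomputable def wP (a : ℕ → ℝ) (f : (X 0).carrier → ℝ) (F : Finset G) (ε : ℝ) :
    (i : ℕ) → Set (X i).carrier → ℝ
  | 0, Ω => sInf {s | ∃ (n : ℕ) (U : Fin n → Set (X 0).carrier),
      (∀ j, IsOpen (U j)) ∧ (Ω ⊆ ⋃ j, U j) ∧ (∀ j, diamLT (X 0) F (U j) ε) ∧
      s = ∑ j, Real.exp (sSup (birk (X 0) f F '' U j))}
  | i + 1, Ω => sInf {s | ∃ (n : ℕ) (U : Fin n → Set (X (i + 1)).carrier),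
      (∀ j, IsOpen (U j)) ∧ (Ω ⊆ ⋃ j, U j) ∧ (∀ j, diamLT (X (i + 1)) F (U j) ε) ∧
      s = ∑ j, (wP a f F ε i ((π i).toFun ⁻¹' U j)) ^ (a i)}

/-- `lim_n log P^a_r(X_r, f, F_n, ε) / |F_n|` (realized as a `limsup` in `EReal`; by the
Ornstein–Weiss lemma the limit exists, so this is the limit). -/
noncomputable def pressEps (r : ℕ) (a : ℕ → ℝ) (f : (X 0).carrier → ℝ)
    (Fn : ℕ → Finset G) (ε : ℝ) : EReal :=
  limsup (fun n =>
    ((Real.log (wP X π a f (Fn n) ε (r - 1) Set.univ) / ((Fn n).card : ℝ) : ℝ) : EReal)) atTop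

/-- The `a`-weighted topological pressure `P^a(f,G) = lim_{ε→0} P^a(X_r,f,ε)`; since
`P^a(X_r,f,ε)` is non-decreasing as `ε` decreases, the limit equals the supremum over `ε > 0`. -/
noncomputable def press (r : ℕ) (a : ℕ → ℝ) (f : (X 0).carrier → ℝ)
    (Fn : ℕ → Finset G) : EReal :=
  ⨆ (ε : ℝ) (_ : 0 < ε), pressEps X π r a f Fn ε

/-- Entropy `H_μ(p)` of a countable partition given by the fibers of `p`. -/
noncomputable def Hpart {Y : Type} [MeasurableSpace Y] {ι : Type}
    (μ : MeasureTheory.Measure Y) (p : Y → ι) : ℝ :=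
  ∑' i : ι, Real.negMulLog ((μ (p ⁻¹' {i})).toReal)

/-- `h_μ(p, G) = lim_n H_μ(p_{F_n})/|F_n|` (realized as a `limsup`, which equals the limit
since the limit exists). -/
noncomputable def hSeq (S : GSystem G) (Fn : ℕ → Finset G)
    (μ : MeasureTheory.Measure S.carrier) (p : S.carrier → ℕ) : ℝ :=
  limsup (fun n =>
    Hpart μ (fun x => fun g : (Fn n : Finset G) => p (S.act (g : G) x)) / ((Fn n).card : ℝ)) atTop

/-- The measure-theoretic entropy `h_μ(X,G)`: supremum of `h_μ(α,G)` over all finite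
measurable partitions (encoded as measurable maps to `ℕ` with finite range). -/
noncomputable def mEnt (S : GSystem G) (Fn : ℕ → Finset G)
    (μ : MeasureTheory.Measure S.carrier) : EReal :=
  ⨆ p : {p : S.carrier → ℕ // Measurable p ∧ (Set.range p).Finite},
    ((hSeq S Fn μ p.1 : ℝ) : EReal)

/-- `μ ∈ M^G(X)`: a `G`-invariant Borel probability measure. -/
def IsInvProb (S : GSystem G) (μ : MeasureTheory.Measure S.carrier) : Prop :=
  MeasureTheory.IsProbabilityMeasure μ ∧ ∀ g : G, μ.map (S.act g) = μ

/-- `π^{(i)} = π_i ∘ ⋯ ∘ π_1 : X_1 → X_{i+1}` (0-indexed). -/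
noncomputable def chainMap : (i : ℕ) → (X 0).carrier → (X i).carrier
  | 0 => id
  | i + 1 => (π i).toFun ∘ chainMap i

/-- The weights `w_1 = a_1⋯a_{r−1}`, `w_i = (1−a_{i−1})a_i⋯a_{r−1}`, `w_r = 1−a_{r−1}`
(0-indexed: `wt a r i` is the paper's `w_{i+1}`, `a j` the paper's `a_{j+1}`). -/
noncomputable def wt (a : ℕ → ℝ) (r i : ℕ) : ℝ :=
  if i = 0 then ∏ j ∈ Finset.range (r - 1), a j
  else (1 - a (i - 1)) * ∏ j ∈ Finset.Ico i (r - 1), a j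

/-- `Σ_{i=1}^r w_i h_{μ_i}(X_i,G) + w_1 ∫ f dμ`. -/
noncomputable def wSum (r : ℕ) (a : ℕ → ℝ) (Fn : ℕ → Finset G) (f : (X 0).carrier → ℝ)
    (μ : MeasureTheory.Measure (X 0).carrier) : EReal :=
  (∑ i ∈ Finset.range r, ((wt a r i : ℝ) : EReal) * mEnt (X i) Fn (μ.map (chainMap X π i)))
    + (((wt a r 0) * ∫ x, f x ∂μ : ℝ) : EReal)

/-- `P^a_var(f,G) = sup_{μ ∈ M^G(X_1)} ( Σ w_i h_{μ_i}(X_i,G) + w_1 ∫ f dμ )`. -/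
noncomputable def Pvar (r : ℕ) (a : ℕ → ℝ) (Fn : ℕ → Finset G)
    (f : (X 0).carrier → ℝ) : EReal :=
  ⨆ μ : {μ : MeasureTheory.Measure (X 0).carrier // IsInvProb (X 0) μ},
    wSum X π r a Fn f μ.1

end WPP

namespace WPP

open MeasureTheory ProbabilityTheory

section RealInequalities

lemma negMulLog_add_mul_log_le {p q : ℝ} (hp : 0 ≤ p) (hq : 0 ≤ q) (h : p ≠ 0 → q ≠ 0) :
    Real.negMulLog p + p * Real.log q ≤ q - p := by
  rcases hp.eq_or_lt with rfl | hp
  · simpa using hq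
  · have hq' : 0 < q := lt_of_le_of_ne hq (Ne.symm (h hp.ne'))
    have h1 := Real.log_le_sub_one_of_pos (div_pos hq' hp)
    rw [Real.log_div hq'.ne' hp.ne'] at h1
    have h2 := mul_le_mul_of_nonneg_left h1 hp.le
    have h3 : p * (q / p - 1) = q - p := by field_simp
    rw [Real.negMulLog]
    linarith

/-- Gibbs' inequality. -/
lemma sum_negMulLog_add_mul_log_le {ι : Type*} [Fintype ι] {p q : ι → ℝ} (hp : ∀ i, 0 ≤ p i)
    (hp1 : ∑ i, p i = 1) (hq : ∀ i, 0 < q i) :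
    ∑ i, (Real.negMulLog (p i) + p i * Real.log (q i)) ≤ Real.log (∑ i, q i) := by
  have hne : (Finset.univ : Finset ι).Nonempty := by
    by_contra h
    rw [Finset.not_nonempty_iff_eq_empty] at h
    simp [h] at hp1
  have hS : 0 < ∑ i, q i := Finset.sum_pos (fun i _ => hq i) hne
  set S := ∑ i, q i with hSdef
  have h1 : ∀ i, Real.negMulLog (p i) + p i * Real.log (q i)
      ≤ (q i / S - p i) + p i * Real.log S := by
    intro i
    have := negMulLog_add_mul_log_le (hp i) (div_pos (hq i) hS).le
      (fun _ => (div_pos (hq i) hS).ne')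
    rw [Real.log_div (hq i).ne' hS.ne'] at this
    linarith
  refine (Finset.sum_le_sum fun i _ => h1 i).trans (le_of_eq ?_)
  rw [Finset.sum_add_distrib, Finset.sum_sub_distrib, ← Finset.sum_div, ← Finset.sum_mul, hp1,
    ← hSdef, div_self hS.ne']
  ring

lemma sum_negMulLog_submodular {A B C : Type*} [Fintype A] [Fintype B] [Fintype C]
    (P : A → B → C → ℝ) (hP : ∀ a b c, 0 ≤ P a b c) :
    ∑ a, ∑ b, ∑ c, Real.negMulLog (P a b c) + ∑ c, Real.negMulLog (∑ a, ∑ b, P a b c)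
      ≤ ∑ a, ∑ c, Real.negMulLog (∑ b, P a b c) + ∑ b, ∑ c, Real.negMulLog (∑ a, P a b c) := by
  set U : A → C → ℝ := fun a c => ∑ b, P a b c with hU
  set V : B → C → ℝ := fun b c => ∑ a, P a b c with hV
  set W : C → ℝ := fun c => ∑ a, ∑ b, P a b c with hW
  have hU0 : ∀ a c, 0 ≤ U a c := fun a c => Finset.sum_nonneg fun b _ => hP a b c
  have hV0 : ∀ b c, 0 ≤ V b c := fun b c => Finset.sum_nonneg fun a _ => hP a b c
  have hW0 : ∀ c, 0 ≤ W c := fun c => Finset.sum_nonneg fun a _ => hU0 a c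
  have hUP : ∀ a b c, P a b c ≤ U a c := fun a b c =>
    Finset.single_le_sum (f := fun b => P a b c) (fun b _ => hP a b c) (Finset.mem_univ b)
  have hVP : ∀ a b c, P a b c ≤ V b c := fun a b c =>
    Finset.single_le_sum (f := fun a => P a b c) (fun a _ => hP a b c) (Finset.mem_univ a)
  have hWU : ∀ a c, U a c ≤ W c := fun a c =>
    Finset.single_le_sum (f := fun a => U a c) (fun a _ => hU0 a c) (Finset.mem_univ a)
  have hterm : ∀ a b c, Real.negMulLog (P a b c)
      + (P a b c * Real.log (U a c) + P a b c * Real.log (V b c) - P a b c * Real.log (W c))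
      ≤ U a c * V b c / W c - P a b c := by
    intro a b c
    rcases (hP a b c).eq_or_lt with h0 | h0
    · rw [← h0]
      simpa using div_nonneg (mul_nonneg (hU0 a c) (hV0 b c)) (hW0 c)
    · have hu : 0 < U a c := h0.trans_le (hUP a b c)
      have hv : 0 < V b c := h0.trans_le (hVP a b c)
      have hw : 0 < W c := hu.trans_le (hWU a c)
      have := negMulLog_add_mul_log_le h0.le (div_pos (mul_pos hu hv) hw).le
        (fun _ => (div_pos (mul_pos hu hv) hw).ne')
      rw [Real.log_div (mul_pos hu hv).ne' hw.ne', Real.log_mul hu.ne' hv.ne'] at this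
      linarith
  have hsum := Finset.sum_le_sum fun a (_ : a ∈ Finset.univ) =>
    Finset.sum_le_sum fun b (_ : b ∈ Finset.univ) =>
      Finset.sum_le_sum fun c (_ : c ∈ Finset.univ) => hterm a b c
  simp only [Finset.sum_add_distrib, Finset.sum_sub_distrib] at hsum
  have e1 : ∑ a, ∑ b, ∑ c, P a b c * Real.log (U a c) = - ∑ a, ∑ c, Real.negMulLog (U a c) := by
    rw [← Finset.sum_neg_distrib]
    refine Finset.sum_congr rfl fun a _ => ?_
    rw [Finset.sum_comm, ← Finset.sum_neg_distrib]
    refine Finset.sum_congr rfl fun c _ => ?_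
    rw [← Finset.sum_mul, Real.negMulLog]
    simp [hU]
  have e2 : ∑ a, ∑ b, ∑ c, P a b c * Real.log (V b c) = - ∑ b, ∑ c, Real.negMulLog (V b c) := by
    rw [Finset.sum_comm, ← Finset.sum_neg_distrib]
    refine Finset.sum_congr rfl fun b _ => ?_
    rw [Finset.sum_comm, ← Finset.sum_neg_distrib]
    refine Finset.sum_congr rfl fun c _ => ?_
    rw [← Finset.sum_mul, Real.negMulLog]
    simp [hV]
  have e0 : ∀ f : A → B → C → ℝ, ∑ a, ∑ b, ∑ c, f a b c = ∑ c, ∑ a, ∑ b, f a b c := by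
    intro f
    calc ∑ a, ∑ b, ∑ c, f a b c = ∑ a, ∑ c, ∑ b, f a b c :=
          Finset.sum_congr rfl fun a _ => Finset.sum_comm
      _ = _ := Finset.sum_comm
  have e3 : ∑ a, ∑ b, ∑ c, P a b c * Real.log (W c) = - ∑ c, Real.negMulLog (W c) := by
    rw [e0, ← Finset.sum_neg_distrib]
    refine Finset.sum_congr rfl fun c _ => ?_
    simp_rw [← Finset.sum_mul]
    simp [hW, Real.negMulLog]
  have e4 : ∑ a, ∑ b, ∑ c, U a c * V b c / W c = ∑ a, ∑ b, ∑ c, P a b c := by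
    rw [e0, e0]
    refine Finset.sum_congr rfl fun c _ => ?_
    have hVW : ∑ b, V b c = W c := Finset.sum_comm
    have hUW : ∑ a, U a c = W c := rfl
    simp_rw [← Finset.sum_div, ← Finset.mul_sum, ← Finset.sum_mul, hVW, hUW]
    change W c * W c / W c = W c
    exact mul_self_div_self _
  rw [e1, e2, e3, e4] at hsum
  linarith

end RealInequalities

section Entropy

variable {Y : Type} [MeasurableSpace Y] {ι κ A B C : Type}

lemma Hpart_fintype [Fintype ι] (μ : Measure Y) (p : Y → ι) :
    Hpart μ p = ∑ i, Real.negMulLog (μ.real (p ⁻¹' {i})) := by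
  rw [Hpart, tsum_fintype]; rfl

lemma Hpart_comp_injective (μ : Measure Y) (p : Y → ι) {φ : ι → κ} (hφ : Function.Injective φ) :
    Hpart μ (fun x => φ (p x)) = Hpart μ p := by
  unfold Hpart
  rw [← hφ.tsum_eq]
  · refine tsum_congr fun i => ?_
    congr 3
    ext x
    simp [hφ.eq_iff]
  · intro k hk
    by_contra hk'
    refine hk ?_
    have : (fun x => φ (p x)) ⁻¹' {k} = ∅ := by
      ext x
      simp only [Set.mem_preimage, Set.mem_singleton_iff, Set.mem_empty_iff_false, iff_false]
      exact fun h => hk' ⟨_, h⟩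
    simp [this]

/-- The entropy of a partition depends only on the induced equivalence relation. -/
lemma Hpart_congr (μ : Measure Y) {p : Y → ι} {q : Y → κ}
    (h : ∀ x y, p x = p y ↔ q x = q y) : Hpart μ p = Hpart μ q := by
  have hker : Setoid.ker p = Setoid.ker q := Setoid.ext fun x y => h x y
  have hp : Hpart μ p = Hpart μ (fun x => (Quotient.mk (Setoid.ker p) x)) :=
    Hpart_comp_injective μ (fun x => Quotient.mk (Setoid.ker p) x) (Setoid.kerLift_injective p)
  have hq : Hpart μ q = Hpart μ (fun x => (Quotient.mk (Setoid.ker q) x)) :=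
    Hpart_comp_injective μ (fun x => Quotient.mk (Setoid.ker q) x) (Setoid.kerLift_injective q)
  rw [hp, hq, hker]

lemma Hpart_map {Z : Type} [MeasurableSpace Z] (μ : Measure Y) {f : Y → Z} (hf : Measurable f)
    {p : Z → ι} (hp : ∀ i, MeasurableSet (p ⁻¹' {i})) :
    Hpart (μ.map f) p = Hpart μ (fun x => p (f x)) := by
  unfold Hpart
  refine tsum_congr fun i => ?_
  rw [Measure.map_apply hf (hp i)]
  rfl

lemma sum_real_inter_preimage [Fintype ι] (μ : Measure Y) [IsFiniteMeasure μ] {p : Y → ι}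
    (hp : ∀ i, MeasurableSet (p ⁻¹' {i})) (S : Set Y) :
    ∑ i, μ.real (S ∩ p ⁻¹' {i}) = μ.real S := by
  have h := sum_measureReal_preimage_singleton (μ := μ.restrict S) (f := p) Finset.univ
    (fun i _ => hp i)
  simp only [Finset.coe_univ, Set.preimage_univ] at h
  rw [measureReal_restrict_apply MeasurableSet.univ, Set.univ_inter] at h
  rw [← h]
  refine Finset.sum_congr rfl fun i _ => ?_
  rw [measureReal_restrict_apply (hp i), Set.inter_comm]

lemma sum_real_preimage [Fintype ι] (μ : Measure Y) [IsProbabilityMeasure μ] {p : Y → ι}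
    (hp : ∀ i, MeasurableSet (p ⁻¹' {i})) : ∑ i, μ.real (p ⁻¹' {i}) = 1 := by
  simpa using sum_real_inter_preimage μ hp Set.univ

lemma Hpart_nonneg (μ : Measure Y) [IsProbabilityMeasure μ] (p : Y → ι) : 0 ≤ Hpart μ p :=
  tsum_nonneg fun _ => Real.negMulLog_nonneg ENNReal.toReal_nonneg
    (ENNReal.toReal_le_of_le_ofReal zero_le_one (by simpa using prob_le_one))

lemma Hpart_const (μ : Measure Y) [IsProbabilityMeasure μ] {p : Y → ι}
    (h : ∀ x y, p x = p y) : Hpart μ p = 0 := by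
  rw [Hpart_congr μ (q := fun _ => ()) (by simpa using h)]
  simp [Hpart]

lemma Hpart_le_log_card [Fintype ι] (μ : Measure Y) [IsProbabilityMeasure μ] {p : Y → ι}
    (hp : ∀ i, MeasurableSet (p ⁻¹' {i})) : Hpart μ p ≤ Real.log (Fintype.card ι) := by
  have := sum_negMulLog_add_mul_log_le (p := fun i => μ.real (p ⁻¹' {i})) (q := fun _ => 1)
    (fun i => measureReal_nonneg) (sum_real_preimage μ hp) (fun _ => one_pos)
  rw [Hpart_fintype]
  simpa using this

lemma measurableSet_preimage_prodMk {p : Y → A} {q : Y → B}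
    (hp : ∀ i, MeasurableSet (p ⁻¹' {i})) (hq : ∀ i, MeasurableSet (q ⁻¹' {i})) (i : A × B) :
    MeasurableSet ((fun x => (p x, q x)) ⁻¹' {i}) := by
  have : (fun x => (p x, q x)) ⁻¹' {i} = p ⁻¹' {i.1} ∩ q ⁻¹' {i.2} := by
    ext x; simp [Prod.ext_iff]
  rw [this]
  exact (hp _).inter (hq _)

lemma measurableSet_preimage_pi [Finite κ] {p : κ → Y → ι}
    (hp : ∀ k i, MeasurableSet (p k ⁻¹' {i})) (i : κ → ι) :
    MeasurableSet ((fun x k => p k x) ⁻¹' {i}) := by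
  have : (fun x k => p k x) ⁻¹' {i} = ⋂ k, p k ⁻¹' {i k} := by
    ext x; simp [funext_iff]
  rw [this]
  exact MeasurableSet.iInter fun k => hp k _

/-- Strong subadditivity of the Shannon entropy. -/
lemma Hpart_submodular [Fintype A] [Fintype B] [Fintype C] (μ : Measure Y) [IsFiniteMeasure μ]
    {p : Y → A} {q : Y → B} {s : Y → C} (hp : ∀ i, MeasurableSet (p ⁻¹' {i}))
    (hq : ∀ i, MeasurableSet (q ⁻¹' {i})) :
    Hpart μ (fun x => (p x, q x, s x)) + Hpart μ s
      ≤ Hpart μ (fun x => (p x, s x)) + Hpart μ (fun x => (q x, s x)) := by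
  have key := sum_negMulLog_submodular
    (fun a b c => μ.real (p ⁻¹' {a} ∩ q ⁻¹' {b} ∩ s ⁻¹' {c})) (fun _ _ _ => measureReal_nonneg)
  have h1 : ∀ a c, ∑ b, μ.real (p ⁻¹' {a} ∩ q ⁻¹' {b} ∩ s ⁻¹' {c})
      = μ.real (p ⁻¹' {a} ∩ s ⁻¹' {c}) := by
    intro a c
    rw [← sum_real_inter_preimage μ hq]
    refine Finset.sum_congr rfl fun b _ => ?_
    rw [Set.inter_right_comm]
  have h2 : ∀ b c, ∑ a, μ.real (p ⁻¹' {a} ∩ q ⁻¹' {b} ∩ s ⁻¹' {c})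
      = μ.real (q ⁻¹' {b} ∩ s ⁻¹' {c}) := by
    intro b c
    rw [← sum_real_inter_preimage μ hp]
    refine Finset.sum_congr rfl fun a _ => ?_
    rw [Set.inter_assoc, Set.inter_comm]
  have h3 : ∀ c, ∑ a, μ.real (p ⁻¹' {a} ∩ s ⁻¹' {c}) = μ.real (s ⁻¹' {c}) := by
    intro c
    rw [← sum_real_inter_preimage μ hp]
    refine Finset.sum_congr rfl fun a _ => ?_
    rw [Set.inter_comm]
  simp only [h1, h2, h3] at key
  simp only [Hpart_fintype, Fintype.sum_prod_type]
  refine le_of_eq_of_le ?_ (key.trans_eq ?_)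
  · congr 1
    refine Finset.sum_congr rfl fun a _ => Finset.sum_congr rfl fun b _ =>
      Finset.sum_congr rfl fun c _ => ?_
    congr 2
    ext x; simp [Prod.ext_iff, and_assoc]
  · congr 1
    · refine Finset.sum_congr rfl fun a _ => Finset.sum_congr rfl fun b _ => ?_
      congr 2
      ext x; simp [Prod.ext_iff]
    · refine Finset.sum_congr rfl fun a _ => Finset.sum_congr rfl fun b _ => ?_
      congr 2
      ext x; simp [Prod.ext_iff]

lemma Hpart_le_Hpart_prodMk [Fintype A] [Fintype C] (μ : Measure Y) [IsFiniteMeasure μ]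
    {p : Y → A} {s : Y → C} (hp : ∀ i, MeasurableSet (p ⁻¹' {i})) :
    Hpart μ s ≤ Hpart μ (fun x => (p x, s x)) := by
  have h := Hpart_submodular μ (s := s) hp hp
  rw [Hpart_congr μ (p := fun x => (p x, p x, s x)) (q := fun x => (p x, s x))
    (fun x y => by simp)] at h
  linarith

/-- The chain rule for entropy, with a partition chosen separately on each cell of `γ`. -/
lemma Hpart_sigma [Fintype ι] {κ : ι → Type} [∀ k, Fintype (κ k)] (μ : Measure Y)
    [IsProbabilityMeasure μ] {γ : Y → ι} (hγ : ∀ k, MeasurableSet (γ ⁻¹' {k}))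
    {E : ∀ k, Y → κ k} (hE : ∀ k b, MeasurableSet (E k ⁻¹' {b})) :
    Hpart μ (fun x => (⟨γ x, E (γ x) x⟩ : Σ k, κ k))
      = Hpart μ γ + ∑ k, μ.real (γ ⁻¹' {k}) * Hpart (μ[|γ ⁻¹' {k}]) (E k) := by
  simp only [Hpart_fintype, Fintype.sum_sigma]
  rw [← Finset.sum_add_distrib]
  refine Finset.sum_congr rfl fun k _ => ?_
  have hset : ∀ b, (fun x => (⟨γ x, E (γ x) x⟩ : Σ k, κ k)) ⁻¹' {⟨k, b⟩}
      = γ ⁻¹' {k} ∩ E k ⁻¹' {b} := by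
    intro b
    ext x
    simp only [Set.mem_preimage, Set.mem_singleton_iff, Set.mem_inter_iff]
    constructor
    · intro h
      obtain ⟨h1, h2⟩ := Sigma.mk.inj_iff.1 h
      subst h1
      exact ⟨rfl, eq_of_heq h2⟩
    · rintro ⟨rfl, rfl⟩
      rfl
  simp only [hset]
  by_cases h0 : μ (γ ⁻¹' {k}) = 0
  · have h1 : μ.real (γ ⁻¹' {k}) = 0 := by simp [Measure.real, h0]
    have h2 : ∀ b, μ.real (γ ⁻¹' {k} ∩ E k ⁻¹' {b}) = 0 := fun b => by
      rw [Measure.real, measure_mono_null Set.inter_subset_left h0]; rfl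
    simp [h1, h2]
  · have : IsProbabilityMeasure (μ[|γ ⁻¹' {k}]) := cond_isProbabilityMeasure h0
    have hreal : ∀ b, μ.real (γ ⁻¹' {k} ∩ E k ⁻¹' {b})
        = μ.real (γ ⁻¹' {k}) * (μ[|γ ⁻¹' {k}]).real (E k ⁻¹' {b}) := by
      intro b
      rw [Measure.real, Measure.real, Measure.real, ← ENNReal.toReal_mul, cond_apply (hγ k),
        ← mul_assoc, ENNReal.mul_inv_cancel h0 (measure_ne_top _ _), one_mul]
    simp only [hreal, Real.negMulLog_mul, Finset.sum_add_distrib, ← Finset.sum_mul,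
      ← Finset.mul_sum, sum_real_preimage _ (hE k), one_mul]

end Entropy

section Fano

variable {Y : Type} [MeasurableSpace Y] {ι κ : Type}

lemma Hpart_prodMk_le_of_error [Fintype ι] [Fintype κ] (μ : Measure Y) [IsProbabilityMeasure μ]
    {p : Y → ι} {D : Y → κ} (hp : ∀ i, MeasurableSet (p ⁻¹' {i}))
    (hD : ∀ i, MeasurableSet (D ⁻¹' {i})) (q : κ → ι) {η τ : ℝ} (hη : 0 ≤ η) (hτ : 0 < τ)
    (hητ : Real.exp (-η) + Fintype.card ι * τ ≤ 1) :
    Hpart μ (fun x => (p x, D x))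
      ≤ Hpart μ D + (η + μ.real {x | p x ≠ q (D x)} * (-Real.log τ)) := by
  classical
  set P : ι → κ → ℝ := fun i d => μ.real (D ⁻¹' {d} ∩ p ⁻¹' {i}) with hP
  set M : κ → ℝ := fun d => μ.real (D ⁻¹' {d}) with hM
  set c : ι → κ → ℝ := fun i d => if i = q d then Real.exp (-η) else τ with hc
  have hP0 : ∀ i d, 0 ≤ P i d := fun _ _ => measureReal_nonneg
  have hM0 : ∀ d, 0 ≤ M d := fun _ => measureReal_nonneg
  have hPM : ∀ i d, P i d ≤ M d := fun i d => measureReal_mono Set.inter_subset_left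
  have hc0 : ∀ i d, 0 < c i d := fun i d => by
    simp only [hc]; split_ifs
    · exact Real.exp_pos _
    · exact hτ
  have hsumP : ∀ d, ∑ i, P i d = M d := fun d => sum_real_inter_preimage μ hp _
  have hsumM : ∑ d, M d = 1 := sum_real_preimage μ hD
  have hpD : ∀ i d, (fun x => (p x, D x)) ⁻¹' {(i, d)} = D ⁻¹' {d} ∩ p ⁻¹' {i} := fun i d => by
    ext x; simp [Prod.ext_iff, and_comm]
  have hterm : ∀ i d, Real.negMulLog (P i d) + P i d * Real.log (M d) + P i d * Real.log (c i d)
      ≤ M d * c i d - P i d := by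
    intro i d
    rcases (hP0 i d).eq_or_lt with h0 | h0
    · rw [← h0]
      simpa using mul_nonneg (hM0 d) (hc0 i d).le
    · have hm := h0.trans_le (hPM i d)
      have := negMulLog_add_mul_log_le h0.le (mul_pos hm (hc0 i d)).le
        (fun _ => (mul_pos hm (hc0 i d)).ne')
      rw [Real.log_mul hm.ne' (hc0 i d).ne'] at this
      linarith
  have hsum := Finset.sum_le_sum fun i (_ : i ∈ Finset.univ) =>
    Finset.sum_le_sum fun d (_ : d ∈ Finset.univ) => hterm i d
  simp only [Finset.sum_add_distrib, Finset.sum_sub_distrib] at hsum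
  have e1 : ∑ i, ∑ d, P i d * Real.log (M d) = - Hpart μ D := by
    rw [Hpart_fintype, Finset.sum_comm, ← Finset.sum_neg_distrib]
    refine Finset.sum_congr rfl fun d _ => ?_
    rw [← Finset.sum_mul, hsumP, Real.negMulLog]
    simp [hM]
  have e2 : ∑ i, ∑ d, P i d = 1 := by
    rw [Finset.sum_comm]; simp only [hsumP, hsumM]
  have e3 : ∑ i, ∑ d, Real.negMulLog (P i d) = Hpart μ (fun x => (p x, D x)) := by
    rw [Hpart_fintype, Fintype.sum_prod_type]; simp only [hpD, hP]
  have e4 : ∑ i, ∑ d, M d * c i d ≤ 1 := by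
    rw [Finset.sum_comm, ← hsumM]
    refine Finset.sum_le_sum fun d _ => ?_
    rw [← Finset.mul_sum]
    refine mul_le_of_le_one_right (hM0 d) (le_trans ?_ hητ)
    have : ∀ i, c i d ≤ (if i = q d then Real.exp (-η) else 0) + τ := fun i => by
      simp only [hc]; split_ifs
      · linarith
      · linarith
    refine (Finset.sum_le_sum fun i _ => this i).trans (le_of_eq ?_)
    simp [Finset.sum_add_distrib]
  have e5 : ∑ i, ∑ d, (if i = q d then 0 else P i d) = μ.real {x | p x ≠ q (D x)} := by
    rw [← sum_real_inter_preimage μ (measurableSet_preimage_prodMk hp hD), Fintype.sum_prod_type]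
    refine Finset.sum_congr rfl fun i _ => Finset.sum_congr rfl fun d _ => ?_
    rw [hpD]
    split_ifs with h
    · have : {x | p x ≠ q (D x)} ∩ (D ⁻¹' {d} ∩ p ⁻¹' {i}) = ∅ := by
        ext x
        simp only [Set.mem_inter_iff, Set.mem_ofPred_eq, Set.mem_preimage, Set.mem_singleton_iff,
          Set.mem_empty_iff_false, iff_false]
        rintro ⟨h1, h2, h3⟩
        exact h1 (by rw [h2, h3, h])
      rw [this]; simp
    · rw [Set.inter_eq_right.2]
      rintro x ⟨h1, h2⟩
      simp only [Set.mem_preimage, Set.mem_singleton_iff] at h1 h2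
      simpa [h1, h2] using h
  have e6 : -(∑ i, ∑ d, P i d * Real.log (c i d))
      ≤ η + μ.real {x | p x ≠ q (D x)} * (-Real.log τ) := by
    rw [← e5, Finset.sum_mul, ← one_mul η, ← e2, Finset.sum_mul, ← Finset.sum_neg_distrib,
      ← Finset.sum_add_distrib]
    refine Finset.sum_le_sum fun i _ => ?_
    rw [Finset.sum_mul, Finset.sum_mul, ← Finset.sum_neg_distrib, ← Finset.sum_add_distrib]
    refine Finset.sum_le_sum fun d _ => ?_
    simp only [hc]
    split_ifs
    · rw [Real.log_exp]; linarith
    · nlinarith [mul_nonneg (hP0 i d) hη]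
  rw [e1, e2, e3] at hsum
  linarith

/-- Fano's inequality: if `D` predicts `p` with small error, then the conditional entropy of `p`
given `D` is small, uniformly in `D`. -/
lemma exists_pos_Hpart_prodMk_le (ι : Type) [Fintype ι] {c : ℝ} (hc : 0 < c) :
    ∃ δ > 0, ∀ {Y : Type} [MeasurableSpace Y] (μ : Measure Y) [IsProbabilityMeasure μ]
      {κ : Type} [Fintype κ] {p : Y → ι} {D : Y → κ}, (∀ i, MeasurableSet (p ⁻¹' {i})) →
      (∀ i, MeasurableSet (D ⁻¹' {i})) → ∀ q : κ → ι, μ.real {x | p x ≠ q (D x)} ≤ δ →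
      Hpart μ (fun x => (p x, D x)) ≤ Hpart μ D + c := by
  set N : ℝ := Fintype.card ι + 1
  have hN : (1 : ℝ) ≤ N := by simp [N]
  have he : Real.exp (-(c / 2)) < 1 := by rw [Real.exp_lt_one_iff]; linarith
  have he0 := Real.exp_pos (-(c / 2))
  set τ : ℝ := (1 - Real.exp (-(c / 2))) / N
  have hτ : 0 < τ := div_pos (by linarith) (by linarith)
  have hτN : N * τ = 1 - Real.exp (-(c / 2)) := mul_div_cancel₀ _ (by linarith)
  have hτ1 : τ ≤ 1 := by nlinarith
  have hlog : 0 ≤ -Real.log τ := by have := Real.log_nonpos hτ.le hτ1; linarith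
  refine ⟨c / 2 / (-Real.log τ + 1), div_pos (by linarith) (by linarith), ?_⟩
  intro Y _ μ _ κ _ p D hp hD q hq
  have h1 := Hpart_prodMk_le_of_error μ hp hD q (η := c / 2) (τ := τ) (by linarith) hτ (by
    have : N * τ = Fintype.card ι * τ + τ := by simp only [N]; ring
    linarith)
  rw [le_div_iff₀ (by linarith)] at hq
  have h2 : 0 ≤ μ.real {x | p x ≠ q (D x)} := measureReal_nonneg
  nlinarith

end Fano

section Shearer

/-- Shearer's inequality for submodular set functions. -/
lemma shearer {α β : Type*} [DecidableEq α] {h : Finset α → ℝ} (h0 : h ∅ = 0)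
    (hsub : ∀ (f : α) (T F : Finset α), T ⊆ F → f ∉ F →
      h (insert f F) + h T ≤ h (insert f T) + h F)
    (I : Finset β) (S : β → Finset α) (k : ℕ) (F : Finset α)
    (hk : ∀ f ∈ F, (I.filter fun g => f ∈ S g).card = k) :
    k * h F ≤ ∑ g ∈ I, h (F ∩ S g) := by
  induction F using Finset.induction_on with
  | empty => simp [h0]
  | insert f F hf ih =>
    have ih' := ih fun f' hf' => hk f' (Finset.mem_insert_of_mem hf')
    have hterm : ∀ g ∈ I, h (F ∩ S g) + (if f ∈ S g then h (insert f F) - h F else 0)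
        ≤ h (insert f F ∩ S g) := by
      intro g _
      split_ifs with hg
      · rw [Finset.insert_inter_of_mem hg]
        have := hsub f (F ∩ S g) F Finset.inter_subset_left hf
        linarith
      · rw [Finset.insert_inter_of_notMem hg, add_zero]
    have hsum := Finset.sum_le_sum hterm
    rw [Finset.sum_add_distrib, ← Finset.sum_filter, Finset.sum_const,
      hk f (Finset.mem_insert_self _ _), nsmul_eq_mul] at hsum
    linarith

variable {G Y : Type} [MeasurableSpace Y] {ι κ : Type}

/-- The joint entropy of `D` and the partitions `P g` for `g ∈ F`. -/
noncomputable def Hjoint (μ : Measure Y) (P : G → Y → ι) (D : Y → κ) (F : Finset G) : ℝ :=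
  Hpart μ (fun x => ((fun g : F => P g x), D x))

lemma Hjoint_insert_add_le [DecidableEq G] [Fintype ι] [Fintype κ] (μ : Measure Y)
    [IsFiniteMeasure μ] {P : G → Y → ι} (hP : ∀ g i, MeasurableSet (P g ⁻¹' {i})) (D : Y → κ)
    (f : G) {T F : Finset G} (hTF : T ⊆ F) :
    Hjoint μ P D (insert f F) + Hjoint μ P D T ≤ Hjoint μ P D (insert f T) + Hjoint μ P D F := by
  have h := Hpart_submodular μ (p := P f) (q := fun x => fun g : F => P g x)
    (s := fun x => ((fun g : T => P g x), D x)) (hP f)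
    (measurableSet_preimage_pi fun g i => hP g i)
  have hT : ∀ x y, (∀ g ∈ F, P g x = P g y) → ∀ g ∈ T, P g x = P g y :=
    fun x y h g hg => h g (hTF hg)
  have e1 : Hjoint μ P D (insert f F) = Hpart μ (fun x => (P f x, (fun g : F => P g x),
      (fun g : T => P g x), D x)) := Hpart_congr μ fun x y => by
    have := hT x y
    simp only [Prod.mk.injEq, funext_iff, Subtype.forall, Finset.forall_mem_insert]
    tauto
  have e2 : Hjoint μ P D (insert f T) = Hpart μ (fun x => (P f x, (fun g : T => P g x), D x)) :=
    Hpart_congr μ fun x y => by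
      simp only [Prod.mk.injEq, funext_iff, Subtype.forall, Finset.forall_mem_insert]
      tauto
  have e3 : Hjoint μ P D F = Hpart μ (fun x => ((fun g : F => P g x),
      (fun g : T => P g x), D x)) := Hpart_congr μ fun x y => by
    have := hT x y
    simp only [Prod.mk.injEq, funext_iff, Subtype.forall]
    tauto
  rw [e1, e2, e3]
  exact h

lemma Hjoint_le_card_mul_log [Fintype ι] (μ : Measure Y)
    [IsProbabilityMeasure μ] {P : G → Y → ι} (hP : ∀ g i, MeasurableSet (P g ⁻¹' {i}))
    (F : Finset G) :
    Hjoint μ P (fun _ => ()) F ≤ F.card * Real.log (Fintype.card ι) := by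
  classical
  refine (Hpart_le_log_card μ (measurableSet_preimage_prodMk (measurableSet_preimage_pi
      fun (k : F) i => hP k i) fun _ => by simp)).trans_eq ?_
  simp

lemma Hpart_pi_le_add_sum [Fintype ι] [Fintype κ] (μ : Measure Y)
    [IsFiniteMeasure μ] {P : G → Y → ι} (hP : ∀ g i, MeasurableSet (P g ⁻¹' {i}))
    {D : Y → κ} (hD : ∀ i, MeasurableSet (D ⁻¹' {i})) (F : Finset G) :
    Hpart μ (fun x => fun g : F => P g x)
      ≤ Hpart μ D + ∑ g ∈ F, (Hpart μ (fun x => (P g x, D x)) - Hpart μ D) := by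
  classical
  have h0 : Hjoint μ P D ∅ = Hpart μ D := Hpart_congr μ fun x y => by
    simp [funext_iff]
  have h1 : ∀ g, Hjoint μ P D {g} = Hpart μ (fun x => (P g x, D x)) := fun g =>
    Hpart_congr μ fun x y => by simp [funext_iff]
  have hle : Hpart μ (fun x => fun g : F => P g x) ≤ Hjoint μ P D F := by
    refine (Hpart_le_Hpart_prodMk μ hD).trans_eq (Hpart_congr μ fun x y => ?_)
    simp only [Prod.mk.injEq]
    tauto
  have h := shearer (h := fun F => Hjoint μ P D F - Hpart μ D) (by simp [h0])
    (fun f T F hTF _ => by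
      have := Hjoint_insert_add_le μ hP D f hTF
      linarith) F (fun g => {g}) 1 F (fun f hf => by simp [Finset.filter_eq, hf])
  have h2 : ∀ g ∈ F, Hjoint μ P D (F ∩ {g}) - Hpart μ D
      = Hpart μ (fun x => (P g x, D x)) - Hpart μ D := fun g hg => by
    rw [Finset.inter_singleton_of_mem hg, h1]
  rw [Finset.sum_congr rfl h2] at h
  simp only [Nat.cast_one, one_mul] at h
  linarith

end Shearer

section EntropyLimit

lemma tendsto_iInf_of_le_add {u : ℕ → ℝ} (hu : ∀ n, 0 ≤ u n)
    (h : ∀ m, ∃ c : ℕ → ℝ, Tendsto c atTop (nhds 0) ∧ ∀ n, u n ≤ u m + c n) :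
    Tendsto u atTop (nhds (⨅ m, u m)) := by
  have hbdd : BddBelow (Set.range u) := ⟨0, by rintro _ ⟨n, rfl⟩; exact hu n⟩
  refine tendsto_order.2 ⟨fun a ha => .of_forall fun n => ha.trans_le (ciInf_le hbdd n),
    fun a ha => ?_⟩
  obtain ⟨m, hm⟩ := exists_lt_of_ciInf_lt ha
  obtain ⟨c, hc, hle⟩ := h m
  filter_upwards [hc.eventually_lt_const (sub_pos.2 hm)] with n hn
  linarith [hle n]

variable {G : Type} [Group G] (S : GSystem G) {ι : Type}

lemma measurableSet_preimage_act {p : S.carrier → ι} (hp : ∀ i, MeasurableSet (p ⁻¹' {i})) (g : G)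
    (i : ι) : MeasurableSet ((fun x => p (S.act g x)) ⁻¹' {i}) :=
  (S.cont_act g).measurable (hp i)

lemma Hjoint_image_mul_right [DecidableEq G] [Fintype ι] {μ : Measure S.carrier}
    (hμ : IsInvProb S μ) {p : S.carrier → ι} (hp : ∀ i, MeasurableSet (p ⁻¹' {i})) (K : Finset G)
    (g : G) :
    Hjoint μ (fun g x => p (S.act g x)) (fun _ => ()) (K.image (· * g))
      = Hjoint μ (fun g x => p (S.act g x)) (fun _ => ()) K := by
  conv_rhs => rw [Hjoint, ← hμ.2 g]
  rw [Hpart_map μ (S.cont_act g).measurable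
    (measurableSet_preimage_prodMk (measurableSet_preimage_pi
      fun (k : K) i => measurableSet_preimage_act S hp k i) fun _ => by simp)]
  refine Hpart_congr μ fun x y => ?_
  simp only [Prod.mk.injEq, and_true, funext_iff, Subtype.forall, Finset.forall_mem_image,
    S.mul_act]

lemma card_mul_Hjoint_le [Fintype ι] {μ : Measure S.carrier}
    (hμ : IsInvProb S μ) {p : S.carrier → ι} (hp : ∀ i, MeasurableSet (p ⁻¹' {i}))
    {K : Finset G} (hK : K.Nonempty) (F : Finset G) :
    K.card * Hjoint μ (fun g x => p (S.act g x)) (fun _ => ()) F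
      ≤ F.card * Hjoint μ (fun g x => p (S.act g x)) (fun _ => ()) K
        + (folnerB G F K).ncard * (K.card * Real.log (Fintype.card ι)) := by
  classical
  have := hμ.1
  have hP := fun g i => measurableSet_preimage_act S hp g i
  set h := Hjoint μ (fun g x => p (S.act g x)) (fun _ => ()) with hdef
  have hK0 : 0 ≤ h K := Hpart_nonneg _ _
  have hlog : 0 ≤ Real.log (Fintype.card ι) := Real.log_natCast_nonneg _
  set I : Finset G := (F ×ˢ K).image fun z => z.2⁻¹ * z.1 with hI
  have hmemI : ∀ g, g ∈ I ↔ ∃ k ∈ K, k * g ∈ F := by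
    intro g
    simp only [hI, Finset.mem_image, Finset.mem_product, Prod.exists]
    constructor
    · rintro ⟨f, k, ⟨hf, hk⟩, rfl⟩
      exact ⟨k, hk, by simpa using hf⟩
    · rintro ⟨k, hk, hf⟩
      exact ⟨k * g, k, ⟨hf, hk⟩, by simp⟩
  have hsh := shearer (h := h) (Hpart_const _ fun x y => by simp [funext_iff])
    (fun f T F hTF _ => Hjoint_insert_add_le μ hP _ f hTF) I (fun g => K.image (· * g)) K.card F
    (fun f hf => by
      have : (I.filter fun g => f ∈ K.image (· * g)) = K.image fun k => k⁻¹ * f := by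
        ext g
        simp only [Finset.mem_filter, hmemI, Finset.mem_image]
        constructor
        · rintro ⟨_, k, hk, rfl⟩
          exact ⟨k, hk, by simp⟩
        · rintro ⟨k, hk, rfl⟩
          exact ⟨⟨k, hk, by simpa using hf⟩, k, hk, by simp⟩
      rw [this, Finset.card_image_of_injective]
      intro k k' hkk
      simpa using hkk)
  refine hsh.trans ?_
  rw [← Finset.sum_filter_add_sum_filter_not I (fun g => K.image (· * g) ⊆ F)]
  refine add_le_add ?_ ?_
  · have h1 : ∀ g ∈ I.filter (fun g => K.image (· * g) ⊆ F), h (F ∩ K.image (· * g)) = h K := by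
      intro g hg
      rw [Finset.inter_eq_right.2 (Finset.mem_filter.1 hg).2]
      exact Hjoint_image_mul_right S hμ hp K g
    rw [Finset.sum_congr rfl h1, Finset.sum_const, nsmul_eq_mul]
    refine mul_le_mul_of_nonneg_right ?_ hK0
    obtain ⟨k, hk⟩ := hK
    have hmaps : Set.MapsTo (k * ·) (I.filter fun g => K.image (· * g) ⊆ F : Set G) F := by
      intro g hg
      have hsub := (Finset.mem_filter.1 (Finset.mem_coe.1 hg)).2
      exact hsub (Finset.mem_image_of_mem _ hk)
    exact_mod_cast Finset.card_le_card_of_injOn _ hmaps (mul_right_injective k).injOn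
  · have h1 : ∀ g ∈ I.filter (fun g => ¬ K.image (· * g) ⊆ F),
        h (F ∩ K.image (· * g)) ≤ K.card * Real.log (Fintype.card ι) := by
      intro g _
      refine (Hjoint_le_card_mul_log μ hP _).trans (mul_le_mul_of_nonneg_right ?_ hlog)
      exact_mod_cast (Finset.card_le_card Finset.inter_subset_right).trans Finset.card_image_le
    have h2 : folnerB G F K = ↑(I.filter (fun g => ¬ K.image (· * g) ⊆ F)) := by
      ext g
      simp only [folnerB, Set.mem_ofPred_eq, Finset.coe_filter, hmemI, Finset.not_subset,
        Finset.exists_mem_image]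
    rw [h2, Set.ncard_coe_finset]
    exact (Finset.sum_le_sum h1).trans_eq (by rw [Finset.sum_const, nsmul_eq_mul])

lemma exists_tendsto_Hpart_div_card [Fintype ι] {Fn : ℕ → Finset G} (hFn : IsFolner G Fn)
    {μ : Measure S.carrier} (hμ : IsInvProb S μ) {p : S.carrier → ι}
    (hp : ∀ i, MeasurableSet (p ⁻¹' {i})) :
    ∃ L : ℝ, Tendsto (fun n => Hpart μ (fun x => fun g : Fn n => p (S.act g x)) / (Fn n).card)
      atTop (nhds L) := by
  have := hμ.1
  have hJ : ∀ F : Finset G, Hpart μ (fun x => fun g : F => p (S.act g x))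
      = Hjoint μ (fun g x => p (S.act g x)) (fun _ => ()) F := fun F =>
    Hpart_congr μ fun x y => by simp
  have hpos : ∀ n, (0 : ℝ) < (Fn n).card := fun n => by
    exact_mod_cast (hFn.1 n).card_pos
  refine ⟨_, tendsto_iInf_of_le_add (fun n => div_nonneg (Hpart_nonneg _ _) (hpos n).le)
    fun m => ⟨fun n => (folnerB G (Fn n) (Fn m)).ncard / (Fn n).card * Real.log (Fintype.card ι),
      by simpa using (hFn.2 (Fn m) (hFn.1 m)).mul_const (Real.log (Fintype.card ι)), fun n => ?_⟩⟩
  have h := card_mul_Hjoint_le S hμ hp (hFn.1 m) (Fn n)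
  rw [hJ, hJ]
  have hm := hpos m
  have hn := hpos n
  rw [div_add' _ _ _ hm.ne', div_le_div_iff₀ hn hm]
  have e : (Hjoint μ (fun g x => p (S.act g x)) (fun _ => ()) (Fn m)
      + (folnerB G (Fn n) (Fn m)).ncard / (Fn n).card * Real.log (Fintype.card ι)
        * (Fn m).card) * (Fn n).card
      = (Fn n).card * Hjoint μ (fun g x => p (S.act g x)) (fun _ => ()) (Fn m)
        + (folnerB G (Fn n) (Fn m)).ncard * ((Fn m).card * Real.log (Fintype.card ι)) := by
    field_simp
  rw [e, mul_comm]
  exact h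

/-- The limit defining the entropy of a finite partition exists. -/
lemma tendsto_hSeq {Fn : ℕ → Finset G} (hFn : IsFolner G Fn)
    {μ : Measure S.carrier} (hμ : IsInvProb S μ) {p : S.carrier → ℕ} (hp : Measurable p)
    (hfin : (Set.range p).Finite) :
    Tendsto (fun n => Hpart μ (fun x => fun g : Fn n => p (S.act g x)) / (Fn n).card)
      atTop (nhds (hSeq S Fn μ p)) := by
  have := hfin.fintype
  have hp' : ∀ i, MeasurableSet (Set.rangeFactorization p ⁻¹' {i}) := fun i => by
    have : Set.rangeFactorization p ⁻¹' {i} = p ⁻¹' {i.1} := by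
      ext x; simp [Subtype.ext_iff]
    rw [this]
    exact hp (measurableSet_singleton _)
  obtain ⟨L, hL⟩ := exists_tendsto_Hpart_div_card S hFn hμ hp'
  have e : ∀ n, Hpart μ (fun x => fun g : Fn n => Set.rangeFactorization p (S.act g x))
      = Hpart μ (fun x => fun g : Fn n => p (S.act g x)) := fun n =>
    Hpart_congr μ fun x y => by simp [funext_iff, Subtype.ext_iff]
  simp only [e] at hL
  have : hSeq S Fn μ p = L := hL.limsup_eq
  rwa [this]

end EntropyLimit

section Weights

lemma wt_succ (a : ℕ → ℝ) {i j : ℕ} (hj : j ≤ i) : wt a (i + 2) j = a i * wt a (i + 1) j := by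
  rcases Nat.eq_zero_or_pos j with rfl | h0
  · simp [wt, Finset.prod_range_succ, mul_comm]
  · simp only [wt, if_neg h0.ne', Nat.add_sub_cancel, show i + 2 - 1 = i + 1 from rfl]
    rw [Finset.prod_Ico_succ_top hj]
    ring

lemma wt_last (a : ℕ → ℝ) (i : ℕ) : wt a (i + 2) (i + 1) = 1 - a i := by
  simp [wt]

lemma wt_one (a : ℕ → ℝ) : wt a 1 0 = 1 := by simp [wt]

lemma sum_wt (a : ℕ → ℝ) (i : ℕ) : ∑ j ∈ Finset.range (i + 1), wt a (i + 1) j = 1 := by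
  induction i with
  | zero => simp [wt_one]
  | succ i ih =>
    rw [Finset.sum_range_succ, wt_last,
      Finset.sum_congr rfl fun j hj => wt_succ a (Nat.lt_succ_iff.1 (Finset.mem_range.1 hj)),
      ← Finset.mul_sum, ih]
    ring

lemma wt_nonneg {a : ℕ → ℝ} {r : ℕ} (ha : ∀ i < r - 1, a i ∈ Set.Icc (0 : ℝ) 1) {i : ℕ}
    (hi : i < r) : 0 ≤ wt a r i := by
  unfold wt
  split_ifs with h
  · exact Finset.prod_nonneg fun j hj => (ha j (Finset.mem_range.1 hj)).1
  · refine mul_nonneg ?_ (Finset.prod_nonneg fun j hj => (ha j (Finset.mem_Ico.1 hj).2).1)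
    linarith [(ha (i - 1) (by lia)).2]

end Weights

section Covers

variable {G : Type} [Group G]

lemma continuous_dynDist (S : GSystem G) (F : Finset G) (x : S.carrier) :
    Continuous fun y => dynDist S F x y := by
  unfold dynDist
  exact NNReal.continuous_coe.comp (Continuous.finset_sup_apply fun g _ =>
    continuous_const.nndist (S.cont_act g))

lemma dynDist_le_add (S : GSystem G) (F : Finset G) (x y z : S.carrier) :
    dynDist S F y z ≤ dynDist S F x y + dynDist S F x z := by
  unfold dynDist
  rw [← NNReal.coe_add, NNReal.coe_le_coe]
  refine Finset.sup_le fun g hg => ?_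
  refine (nndist_triangle_left _ _ (S.act g x)).trans (add_le_add ?_ ?_)
  · exact Finset.le_sup (f := fun g => nndist (S.act g x) (S.act g y)) hg
  · exact Finset.le_sup (f := fun g => nndist (S.act g x) (S.act g z)) hg

lemma dist_act_le_dynDist (S : GSystem G) {F : Finset G} {g : G} (hg : g ∈ F) (x y : S.carrier) :
    dist (S.act g x) (S.act g y) ≤ dynDist S F x y := by
  rw [dynDist, ← coe_nndist, NNReal.coe_le_coe]
  exact Finset.le_sup (f := fun g => nndist (S.act g x) (S.act g y)) hg

lemma exists_open_cover_diamLT (S : GSystem G) (F : Finset G) {ε : ℝ} (hε : 0 < ε) :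
    ∃ (n : ℕ) (U : Fin n → Set S.carrier), (∀ j, IsOpen (U j)) ∧ (⋃ j, U j) = Set.univ ∧
      ∀ j, diamLT S F (U j) ε := by
  have hopen : ∀ x, IsOpen {y | dynDist S F x y < ε / 2} := fun x =>
    isOpen_lt (continuous_dynDist S F x) continuous_const
  obtain ⟨t, ht⟩ := isCompact_univ.elim_finite_subcover (fun x => {y | dynDist S F x y < ε / 2})
    hopen (fun x _ => Set.mem_iUnion.2 ⟨x, by
      have : dynDist S F x x = 0 := by
        rw [dynDist, NNReal.coe_eq_zero, ← bot_eq_zero, Finset.sup_eq_bot_iff]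
        simp
      simpa [this] using hε⟩)
  refine ⟨t.card, fun j => {y | dynDist S F (t.equivFin.symm j) y < ε / 2}, fun j => hopen _,
    Set.eq_univ_of_forall fun y => ?_, fun j y hy z hz => ?_⟩
  · obtain ⟨x, hx, hxy⟩ := Set.mem_iUnion₂.1 (ht (Set.mem_univ y))
    exact Set.mem_iUnion.2 ⟨t.equivFin ⟨x, hx⟩, by simpa using hxy⟩
  · have := dynDist_le_add S F (t.equivFin.symm j) y z
    simp only [Set.mem_ofPred_eq] at hy hz
    linarith

variable (X : ℕ → GSystem G) (π : ∀ i, FactorMap (X i) (X (i + 1)))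

lemma exists_cover_of_wP_zero_lt {a : ℕ → ℝ} {F : Finset G} {ε : ℝ} (hε : 0 < ε)
    {Ω : Set (X 0).carrier} {s : ℝ} (hs : wP X π a (fun _ => 0) F ε 0 Ω < s) :
    ∃ (n : ℕ) (U : Fin n → Set (X 0).carrier), (∀ j, IsOpen (U j)) ∧ Ω ⊆ ⋃ j, U j ∧
      (∀ j, diamLT (X 0) F (U j) ε) ∧ (n : ℝ) < s := by
  rw [wP] at hs
  obtain ⟨n₀, U₀, h₀o, h₀c, h₀d⟩ := exists_open_cover_diamLT (X 0) F hε
  obtain ⟨t, ⟨n, U, hUo, hUc, hUd, rfl⟩, hts⟩ := exists_lt_of_csInf_lt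
    (by exact ⟨_, n₀, U₀, h₀o, by simp [h₀c], h₀d, rfl⟩) hs
  refine ⟨n, U, hUo, hUc, hUd, ?_⟩
  have : ∀ j, sSup (birk (X 0) (fun _ => 0) F '' U j) = 0 := by
    intro j
    have hb : birk (X 0) (fun _ => 0) F = fun _ => 0 := by ext; simp [birk]
    rw [hb]
    rcases (U j).eq_empty_or_nonempty with h | h
    · simp [h]
    · simp [h.image_const]
  simpa [this] using hts

lemma exists_cover_of_wP_succ_lt {a : ℕ → ℝ} {f : (X 0).carrier → ℝ} {F : Finset G} {ε : ℝ}
    (hε : 0 < ε) {i : ℕ} {Ω : Set (X (i + 1)).carrier} {s : ℝ}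
    (hs : wP X π a f F ε (i + 1) Ω < s) :
    ∃ (n : ℕ) (U : Fin n → Set (X (i + 1)).carrier), (∀ j, IsOpen (U j)) ∧ Ω ⊆ ⋃ j, U j ∧
      (∀ j, diamLT (X (i + 1)) F (U j) ε) ∧
      ∑ j, (wP X π a f F ε i ((π i).toFun ⁻¹' U j)) ^ (a i) < s := by
  rw [wP] at hs
  obtain ⟨n₀, U₀, h₀o, h₀c, h₀d⟩ := exists_open_cover_diamLT (X (i + 1)) F hε
  obtain ⟨t, ⟨n, U, hUo, hUc, hUd, rfl⟩, hts⟩ := exists_lt_of_csInf_lt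
    (by exact ⟨_, n₀, U₀, h₀o, by simp [h₀c], h₀d, rfl⟩) hs
  exact ⟨n, U, hUo, hUc, hUd, hts⟩

lemma wP_nonneg (a : ℕ → ℝ) (f : (X 0).carrier → ℝ) (F : Finset G) (ε : ℝ) (i : ℕ)
    (Ω : Set (X i).carrier) : 0 ≤ wP X π a f F ε i Ω := by
  induction i with
  | zero =>
    refine Real.sInf_nonneg ?_
    rintro _ ⟨n, U, -, -, -, rfl⟩
    exact Finset.sum_nonneg fun _ _ => (Real.exp_pos _).le
  | succ i ih =>
    refine Real.sInf_nonneg ?_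
    rintro _ ⟨n, U, -, -, -, rfl⟩
    exact Finset.sum_nonneg fun _ _ => Real.rpow_nonneg (ih _) _

lemma exists_sum_rpow_lt {ι : Type*} [Fintype ι] {c : ι → ℝ} {b s : ℝ} (hb : 0 ≤ b)
    (h : ∑ k, c k ^ b < s) : ∃ d : ι → ℝ, (∀ k, c k < d k) ∧ ∑ k, d k ^ b < s := by
  have hcont : Continuous fun t : ℝ => ∑ k, (c k + t) ^ b :=
    continuous_finsetSum _ fun k _ => (continuous_const.add continuous_id).rpow_const
      fun _ => Or.inr hb
  have hev : ∀ᶠ t in nhdsWithin (0 : ℝ) (Set.Ioi 0), ∑ k, (c k + t) ^ b < s :=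
    (hcont.continuousAt.eventually_lt_const (by simpa using h)).filter_mono nhdsWithin_le_nhds
  obtain ⟨t, ht, ht0⟩ := (hev.and self_mem_nhdsWithin).exists
  exact ⟨fun k => c k + t, fun k => lt_add_of_pos_right _ ht0, ht⟩

/-- A measurable selection of an element of a finite measurable cover. -/
lemma exists_selection {Y : Type} [MeasurableSpace Y] {n : ℕ} [NeZero n] {U : Fin n → Set Y}
    (hU : ∀ k, MeasurableSet (U k)) :
    ∃ γ : Y → Fin n, (∀ k, MeasurableSet (γ ⁻¹' {k})) ∧ ∀ x ∈ ⋃ k, U k, x ∈ U (γ x) := by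
  classical
  let p : Y → ℕ → Prop := fun x N => (∃ h : N < n, x ∈ U ⟨N, h⟩) ∨ (x ∉ ⋃ k, U k)
  have hp : ∀ x, ∃ N, p x N := fun x => by
    by_cases hx : x ∈ ⋃ k, U k
    · obtain ⟨k, hk⟩ := Set.mem_iUnion.1 hx
      exact ⟨k, Or.inl ⟨k.2, hk⟩⟩
    · exact ⟨0, Or.inr hx⟩
  have hlt : ∀ x, Nat.find (hp x) < n := fun x => by
    by_cases hx : x ∈ ⋃ k, U k
    · obtain ⟨k, hk⟩ := Set.mem_iUnion.1 hx
      exact (Nat.find_min' (hp x) (Or.inl ⟨k.2, hk⟩)).trans_lt k.2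
    · exact (Nat.find_min' (hp x) (Or.inr hx : p x 0)).trans_lt (NeZero.pos n)
  have hmeas : Measurable fun x => Nat.find (hp x) := by
    refine measurable_find hp fun N => ?_
    refine MeasurableSet.union (s₁ := {x | ∃ h : N < n, x ∈ U ⟨N, h⟩}) ?_
      (MeasurableSet.iUnion hU).compl
    by_cases h : N < n
    · simp only [h, exists_true_left]
      exact hU ⟨N, h⟩
    · simp [h]
  refine ⟨fun x => ⟨Nat.find (hp x), hlt x⟩, fun k => ?_, fun x hx => ?_⟩
  · have : (fun x => (⟨Nat.find (hp x), hlt x⟩ : Fin n)) ⁻¹' {k}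
        = (fun x => Nat.find (hp x)) ⁻¹' {k.1} := by
      ext x; simp [Fin.ext_iff]
    rw [this]
    exact hmeas (measurableSet_singleton _)
  · rcases Nat.find_spec (hp x) with ⟨_, h⟩ | h
    · exact h
    · exact absurd hx h

lemma continuous_chainMap (i : ℕ) : Continuous (chainMap X π i) := by
  induction i with
  | zero => exact continuous_id
  | succ i ih => exact (π i).cont.comp ih

lemma chainMap_act (i : ℕ) (g : G) (x : (X 0).carrier) :
    chainMap X π i ((X 0).act g x) = (X i).act g (chainMap X π i x) := by
  induction i with
  | zero => rfl
  | succ i ih => simp [chainMap, ih, (π i).equiv]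

/-- The weighted entropies of a suitable hierarchy of partitions that are fine in the dynamical
metrics are controlled by the recursively defined covering quantities. -/
lemma exists_partitions {a : ℕ → ℝ} {F : Finset G} {ε : ℝ} (hε : 0 < ε) (i : ℕ)
    (ha : ∀ j < i, a j ∈ Set.Icc (0 : ℝ) 1) (Ω : Set (X i).carrier) (s : ℝ)
    (hs : wP X π a (fun _ => 0) F ε i Ω < s) :
    ∃ (κ : Type) (_ : Fintype κ) (D : ℕ → (X 0).carrier → κ),
      (∀ j b, MeasurableSet (D j ⁻¹' {b})) ∧
      (∀ j ≤ i, ∀ x y, chainMap X π i x ∈ Ω → chainMap X π i y ∈ Ω → D j x = D j y →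
        dynDist (X j) F (chainMap X π j x) (chainMap X π j y) < ε) ∧
      ∀ ν : Measure (X 0).carrier, IsProbabilityMeasure ν →
        ν (chainMap X π i ⁻¹' Ω)ᶜ = 0 →
        ∑ j ∈ Finset.range (i + 1), wt a (i + 1) j * Hpart ν (D j) ≤ Real.log s := by
  induction i generalizing s with
  | zero =>
    obtain ⟨n, U, hUo, hUc, hUd, hns⟩ := exists_cover_of_wP_zero_lt X π hε hs
    rcases (chainMap X π 0 ⁻¹' Ω).eq_empty_or_nonempty with hΩ | ⟨x₀, hx₀⟩
    · refine ⟨Unit, inferInstance, fun _ _ => (), by simp, fun j _ x y hx => ?_,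
        fun ν _ hν => ?_⟩
      · exact absurd hx (by simpa using Set.eq_empty_iff_forall_notMem.1 hΩ x)
      · simp [hΩ] at hν
    · obtain ⟨k₀, -⟩ := Set.mem_iUnion.1 (hUc hx₀)
      have : NeZero n := ⟨fun h => by subst h; exact k₀.elim0⟩
      have hn : (0 : ℝ) < n := by exact_mod_cast NeZero.pos n
      obtain ⟨γ, hγ, hγU⟩ := exists_selection fun k => (hUo k).measurableSet
      refine ⟨Fin n, inferInstance, fun _ => γ, fun _ => hγ, fun j hj x y hx hy hxy => ?_,
        fun ν _ hν => ?_⟩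
      · obtain rfl : j = 0 := Nat.le_zero.1 hj
        have hyU : y ∈ U (γ y) := hγU y (hUc hy)
        rw [← show γ x = γ y from hxy] at hyU
        exact hUd (γ x) _ (hγU _ (hUc hx)) _ hyU
      · have h1 := Hpart_le_log_card ν hγ
        rw [Fintype.card_fin] at h1
        simpa [wt_one] using h1.trans (Real.log_le_log hn hns.le)
  | succ i ih =>
    obtain ⟨n, U, hUo, hUc, hUd, hns⟩ := exists_cover_of_wP_succ_lt X π hε hs
    rcases (chainMap X π (i + 1) ⁻¹' Ω).eq_empty_or_nonempty with hΩ | ⟨x₀, hx₀⟩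
    · refine ⟨Unit, inferInstance, fun _ _ => (), by simp, fun j _ x y hx => ?_,
        fun ν _ hν => ?_⟩
      · exact absurd hx (by simpa using Set.eq_empty_iff_forall_notMem.1 hΩ x)
      · simp [hΩ] at hν
    · obtain ⟨k₀, -⟩ := Set.mem_iUnion.1 (hUc hx₀)
      have : NeZero n := ⟨fun h => by subst h; exact k₀.elim0⟩
      obtain ⟨hai0, hai1⟩ := ha i (Nat.lt_succ_self i)
      obtain ⟨d, hd, hds⟩ := exists_sum_rpow_lt hai0 hns
      have hd0 : ∀ k, 0 < d k := fun k => (wP_nonneg X π a _ F ε i _).trans_lt (hd k)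
      choose κ hκ D hDm hDd hDν using fun k =>
        ih (fun j hj => ha j (hj.trans (Nat.lt_succ_self i))) ((π i).toFun ⁻¹' U k) (d k) (hd k)
      obtain ⟨γ, hγ, hγU⟩ := exists_selection (U := fun k => chainMap X π (i + 1) ⁻¹' U k)
        fun k => ((continuous_chainMap X π (i + 1)).isOpen_preimage _ (hUo k)).measurableSet
      have hγU' : ∀ x, chainMap X π (i + 1) x ∈ Ω → chainMap X π (i + 1) x ∈ U (γ x) := by
        intro x hx
        obtain ⟨k, hk⟩ := Set.mem_iUnion.1 (hUc hx)
        exact hγU x (Set.mem_iUnion.2 ⟨k, hk⟩)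
      set E : ℕ → ∀ k, (X 0).carrier → κ k :=
        fun j k x => if j ≤ i then D k j x else D k 0 x₀ with hE
      have hEm : ∀ j k b, MeasurableSet (E j k ⁻¹' {b}) := by
        intro j k b
        by_cases hj : j ≤ i
        · simpa only [hE, if_pos hj] using hDm k j b
        · simp only [hE, if_neg hj]
          exact MeasurableSet.const _
      refine ⟨Σ k, κ k, inferInstance, fun j x => ⟨γ x, E j (γ x) x⟩, fun j b => ?_,
        fun j hj x y hx hy hxy => ?_, fun ν _ hν => ?_⟩
      · obtain ⟨k, b⟩ := b
        have : (fun x => (⟨γ x, E j (γ x) x⟩ : Σ k, κ k)) ⁻¹' {⟨k, b⟩}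
            = γ ⁻¹' {k} ∩ E j k ⁻¹' {b} := by
          ext x
          simp only [Set.mem_preimage, Set.mem_singleton_iff, Set.mem_inter_iff]
          constructor
          · intro h
            obtain ⟨h1, h2⟩ := Sigma.mk.inj_iff.1 h
            subst h1
            exact ⟨rfl, eq_of_heq h2⟩
          · rintro ⟨rfl, rfl⟩
            rfl
        rw [this]
        exact (hγ k).inter (hEm j k b)
      · obtain ⟨h1, h2⟩ := Sigma.mk.inj_iff.1 hxy
        have hxU := hγU' x hx
        have hyU := hγU' y hy
        rw [← h1] at h2 hyU
        rcases hj.eq_or_lt with rfl | hj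
        · exact hUd _ _ hxU _ hyU
        · have hj' := Nat.lt_succ_iff.1 hj
          have h3 := eq_of_heq h2
          simp only [hE, if_pos hj'] at h3
          exact hDd (γ x) j hj' x y hxU hyU h3
      · have hH : ∀ j, Hpart ν (fun x => (⟨γ x, E j (γ x) x⟩ : Σ k, κ k))
            = Hpart ν γ + ∑ k, ν.real (γ ⁻¹' {k}) * Hpart (ν[|γ ⁻¹' {k}]) (E j k) :=
          fun j => Hpart_sigma ν hγ (hEm j)
        have hcell : ∀ k, ν.real (γ ⁻¹' {k}) * ∑ j ∈ Finset.range (i + 2),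
            wt a (i + 2) j * Hpart (ν[|γ ⁻¹' {k}]) (E j k)
            ≤ ν.real (γ ⁻¹' {k}) * Real.log (d k ^ a i) := by
          intro k
          by_cases h0 : ν (γ ⁻¹' {k}) = 0
          · have : ν.real (γ ⁻¹' {k}) = 0 := by simp [Measure.real, h0]
            simp [this]
          refine mul_le_mul_of_nonneg_left ?_ measureReal_nonneg
          have : IsProbabilityMeasure (ν[|γ ⁻¹' {k}]) := cond_isProbabilityMeasure h0
          have hlast : Hpart (ν[|γ ⁻¹' {k}]) (E (i + 1) k) = 0 :=
            Hpart_const _ fun x y => by simp [hE]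
          have hjs : ∀ j ∈ Finset.range (i + 1), wt a (i + 2) j * Hpart (ν[|γ ⁻¹' {k}]) (E j k)
              = a i * (wt a (i + 1) j * Hpart (ν[|γ ⁻¹' {k}]) (D k j)) := by
            intro j hj
            have hj' := Nat.lt_succ_iff.1 (Finset.mem_range.1 hj)
            have hEj : E j k = D k j := by ext x; simp [hE, hj']
            rw [wt_succ a hj', hEj, mul_assoc]
          rw [Finset.sum_range_succ, hlast, mul_zero, add_zero, Finset.sum_congr rfl hjs,
            ← Finset.mul_sum, Real.log_rpow (hd0 k)]
          refine mul_le_mul_of_nonneg_left (hDν k _ this ?_) hai0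
          rw [cond_apply (hγ k)]
          refine mul_eq_zero_of_right _ (measure_mono_null ?_ hν)
          rintro x ⟨hx1, hx2⟩ hx3
          refine hx2 ?_
          have := hγU' x hx3
          rw [show γ x = k from hx1] at this
          exact this
        calc ∑ j ∈ Finset.range (i + 2), wt a (i + 2) j *
              Hpart ν (fun x => (⟨γ x, E j (γ x) x⟩ : Σ k, κ k))
            = Hpart ν γ + ∑ k, ν.real (γ ⁻¹' {k}) * ∑ j ∈ Finset.range (i + 2),
                wt a (i + 2) j * Hpart (ν[|γ ⁻¹' {k}]) (E j k) := by
              simp only [hH, mul_add, Finset.sum_add_distrib, ← Finset.sum_mul]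
              rw [sum_wt a (i + 1), one_mul]
              simp only [Finset.mul_sum]
              rw [Finset.sum_comm]
              congr 1
              refine Finset.sum_congr rfl fun k _ => Finset.sum_congr rfl fun j _ => ?_
              ring
          _ ≤ Hpart ν γ + ∑ k, ν.real (γ ⁻¹' {k}) * Real.log (d k ^ a i) :=
              add_le_add_right (Finset.sum_le_sum fun k _ => hcell k) _
          _ ≤ Real.log (∑ k, d k ^ a i) := by
              rw [Hpart_fintype, ← Finset.sum_add_distrib]
              exact sum_negMulLog_add_mul_log_le (fun _ => measureReal_nonneg)
                (sum_real_preimage ν hγ) fun k => Real.rpow_pos_of_pos (hd0 k) _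
          _ ≤ Real.log s := Real.log_le_log
              (Finset.sum_pos (fun k _ => Real.rpow_pos_of_pos (hd0 k) _) ⟨k₀, Finset.mem_univ _⟩)
              hds.le

end Covers

section LowerBound

variable {G : Type} [Group G]

/-- A finite measurable partition of a compact metric space is uniformly locally constant off a
set of small measure. -/
lemma exists_uniformly_locally_constant {Z ι : Type} [MetricSpace Z] [CompactSpace Z]
    [MeasurableSpace Z] [BorelSpace Z] [Fintype ι] (ν : Measure Z) [IsFiniteMeasure ν] {p : Z → ι}
    (hp : ∀ i, MeasurableSet (p ⁻¹' {i})) {δ : ℝ} (hδ : 0 < δ) :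
    ∃ ε > 0, ∃ C : Set Z, MeasurableSet C ∧ ν.real Cᶜ ≤ δ ∧
      ∀ x ∈ C, ∀ y ∈ C, dist x y < ε → p x = p y := by
  set N : ℝ := Fintype.card ι + 1
  have hN : 0 < N := by positivity
  have hδN : ENNReal.ofReal (δ / N) ≠ 0 := by simpa using div_pos hδ hN
  choose K hKp hKc hK using fun i =>
    (hp i).exists_isClosed_sdiff_lt (μ := ν) (measure_ne_top _ _) hδN
  have hKi : ∀ i, ∀ x ∈ K i, p x = i := fun i x hx => by simpa using hKp i hx
  have hcompact : IsCompact (⋃ i, ⋃ j, ⋃ _ : i ≠ j, K i ×ˢ K j) :=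
    isCompact_iUnion fun i => isCompact_iUnion fun j => isCompact_iUnion fun _ =>
      ((hKc i).isCompact).prod (hKc j).isCompact
  have hε : ∃ ε > 0, ∀ z ∈ ⋃ i, ⋃ j, ⋃ _ : i ≠ j, K i ×ˢ K j, ε ≤ dist z.1 z.2 := by
    rcases (⋃ i, ⋃ j, ⋃ _ : i ≠ j, K i ×ˢ K j).eq_empty_or_nonempty with h | h
    · exact ⟨1, one_pos, by simp [h]⟩
    · obtain ⟨z, hz, hmin⟩ := hcompact.exists_isMinOn h continuous_dist.continuousOn
      refine ⟨dist z.1 z.2, dist_pos.2 fun heq => ?_, fun w hw => hmin hw⟩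
      simp only [Set.mem_iUnion, Set.mem_prod] at hz
      obtain ⟨i, j, hij, h1, h2⟩ := hz
      exact hij (by rw [← hKi i _ h1, ← hKi j _ h2, heq])
  obtain ⟨ε, hε0, hεd⟩ := hε
  refine ⟨ε, hε0, ⋃ i, K i, MeasurableSet.iUnion fun i => (hKc i).measurableSet, ?_, ?_⟩
  · have hsub : (⋃ i, K i)ᶜ ⊆ ⋃ i, p ⁻¹' {i} \ K i := by
      intro x hx
      refine Set.mem_iUnion.2 ⟨p x, rfl, fun h => hx (Set.mem_iUnion.2 ⟨_, h⟩)⟩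
    have hle : ∀ i, ν.real (p ⁻¹' {i} \ K i) ≤ δ / N := fun i =>
      ENNReal.toReal_le_of_le_ofReal (div_pos hδ hN).le (hK i).le
    calc ν.real (⋃ i, K i)ᶜ ≤ ν.real (⋃ i, p ⁻¹' {i} \ K i) := measureReal_mono hsub
      _ ≤ ∑ i, ν.real (p ⁻¹' {i} \ K i) := measureReal_iUnion_fintype_le _
      _ ≤ ∑ _i : ι, δ / N := Finset.sum_le_sum fun i _ => hle i
      _ = Fintype.card ι * (δ / N) := by simp
      _ ≤ N * (δ / N) := mul_le_mul_of_nonneg_right (by simp [N]) (div_pos hδ hN).le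
      _ = δ := mul_div_cancel₀ _ hN.ne'
  · intro x hx y hy hxy
    by_contra hne
    obtain ⟨i, hi⟩ := Set.mem_iUnion.1 hx
    obtain ⟨j, hj⟩ := Set.mem_iUnion.1 hy
    have hij : i ≠ j := fun h => hne (by rw [hKi i x hi, hKi j y hj, h])
    refine not_lt.2 (hεd (x, y) ?_) hxy
    simp only [Set.mem_iUnion, Set.mem_prod]
    exact ⟨i, j, hij, hi, hj⟩

/-- Partitions that are fine in the dynamical metric `dynDist S F` determine the `F`-orbit of a
given finite partition up to a small entropy per element of `F`. -/
lemma exists_eps_Hpart_le (S : GSystem G) {ν : Measure S.carrier} (hν : IsInvProb S ν)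
    {p : S.carrier → ℕ} (hp : Measurable p) (hfin : (Set.range p).Finite) {c : ℝ} (hc : 0 < c) :
    ∃ ε > 0, ∀ {Y : Type} [MeasurableSpace Y] (μ : Measure Y) [IsProbabilityMeasure μ]
      {φ : Y → S.carrier}, Measurable φ → μ.map φ = ν → ∀ (F : Finset G) {κ : Type} [Fintype κ]
      {D : Y → κ}, (∀ b, MeasurableSet (D ⁻¹' {b})) →
      (∀ x y, D x = D y → dynDist S F (φ x) (φ y) < ε) →
      Hpart μ (fun x => fun g : F => p (S.act g (φ x))) ≤ Hpart μ D + F.card * c := by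
  have := hfin.fintype
  have := hν.1
  set p' := Set.rangeFactorization p
  have hp' : ∀ i, MeasurableSet (p' ⁻¹' {i}) := fun i => by
    have : p' ⁻¹' {i} = p ⁻¹' {i.1} := by
      ext x; simp [p', Subtype.ext_iff]
    rw [this]
    exact hp (measurableSet_singleton _)
  obtain ⟨δ, hδ, hfano⟩ := exists_pos_Hpart_prodMk_le (Set.range p) hc
  obtain ⟨ε, hε, C, hC, hCδ, hCε⟩ := exists_uniformly_locally_constant ν hp' hδ
  refine ⟨ε, hε, fun {Y} _ μ _ {φ} hφ hμν F {κ} _ {D} hD hDε => ?_⟩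
  obtain ⟨y₀⟩ : Nonempty Y := nonempty_of_isProbabilityMeasure μ
  have hP : ∀ (g : G) i, MeasurableSet ((fun x => p' (S.act g (φ x))) ⁻¹' {i}) := fun g i =>
    hφ (measurableSet_preimage_act S hp' g i)
  have hstep : ∀ g ∈ F, Hpart μ (fun x => (p' (S.act g (φ x)), D x)) - Hpart μ D ≤ c := by
    intro g hg
    classical
    let q : κ → Set.range p := fun d =>
      if h : ∃ y, D y = d ∧ S.act g (φ y) ∈ C then p' (S.act g (φ h.choose)) else p' (φ y₀)
    have hq : {x | p' (S.act g (φ x)) ≠ q (D x)} ⊆ φ ⁻¹' (S.act g ⁻¹' Cᶜ) := by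
      intro x hx hxC
      refine hx ?_
      have h : ∃ y, D y = D x ∧ S.act g (φ y) ∈ C := ⟨x, rfl, hxC⟩
      simp only [q, dif_pos h]
      exact hCε _ hxC _ h.choose_spec.2
        ((dist_act_le_dynDist S hg _ _).trans_lt (hDε _ _ h.choose_spec.1.symm))
    have hmeas : μ.real (φ ⁻¹' (S.act g ⁻¹' Cᶜ)) = ν.real Cᶜ := by
      have hact := (S.cont_act g).measurable
      rw [Measure.real, Measure.real, ← Measure.map_apply hφ (hact hC.compl), hμν,
        ← Measure.map_apply hact hC.compl, hν.2 g]
    have := hfano μ (hP g) hD q ((measureReal_mono hq).trans (hmeas.le.trans hCδ))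
    linarith
  have hcongr : Hpart μ (fun x => fun g : F => p (S.act g (φ x)))
      = Hpart μ (fun x => fun g : F => p' (S.act g (φ x))) :=
    Hpart_congr μ fun x y => by simp [p', funext_iff, Subtype.ext_iff]
  rw [hcongr]
  refine (Hpart_pi_le_add_sum μ hP hD F).trans (add_le_add_right ?_ _)
  refine (Finset.sum_le_sum hstep).trans_eq ?_
  rw [Finset.sum_const, nsmul_eq_mul]

variable (X : ℕ → GSystem G) (π : ∀ i, FactorMap (X i) (X (i + 1)))

lemma isInvProb_map_chainMap {μ : Measure (X 0).carrier} (hμ : IsInvProb (X 0) μ) (i : ℕ) :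
    IsInvProb (X i) (μ.map (chainMap X π i)) := by
  have := hμ.1
  have hm := (continuous_chainMap X π i).measurable
  refine ⟨Measure.isProbabilityMeasure_map hm.aemeasurable, fun g => ?_⟩
  conv_rhs => rw [← hμ.2 g]
  rw [Measure.map_map ((X i).cont_act g).measurable hm,
    Measure.map_map hm ((X 0).cont_act g).measurable]
  congr 1
  ext x
  exact (chainMap_act X π i g x).symm

lemma exists_eps_sum_wt_mul_Hpart_le {a : ℕ → ℝ} (i : ℕ) (ha : ∀ j < i, a j ∈ Set.Icc (0 : ℝ) 1)
    {μ : Measure (X 0).carrier} (hμ : IsInvProb (X 0) μ) {p : ∀ j, (X j).carrier → ℕ}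
    (hp : ∀ j, Measurable (p j)) (hfin : ∀ j, (Set.range (p j)).Finite) {c : ℝ} (hc : 0 < c) :
    ∃ ε > 0, ∀ F : Finset G,
      ∑ j ∈ Finset.range (i + 1), wt a (i + 1) j *
        Hpart (μ.map (chainMap X π j)) (fun x => fun g : F => p j ((X j).act g x))
      ≤ Real.log (wP X π a (fun _ => 0) F ε i Set.univ) + F.card * c := by
  have := hμ.1
  have hm := fun j => (continuous_chainMap X π j).measurable
  choose e he0 he using fun j =>
    exists_eps_Hpart_le (X j) (isInvProb_map_chainMap X π hμ j) (hp j) (hfin j) hc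
  have hmin : ∃ ε > 0, ∀ j ∈ Finset.range (i + 1), ε ≤ e j := by
    have h1 : ∀ᶠ ε in nhdsWithin (0 : ℝ) (Set.Ioi 0), ∀ j ∈ Finset.range (i + 1), ε ≤ e j := by
      rw [Filter.eventually_all_finset]
      exact fun j _ => (eventually_le_nhds (he0 j)).filter_mono nhdsWithin_le_nhds
    obtain ⟨ε, h, hε⟩ := (h1.and self_mem_nhdsWithin).exists
    exact ⟨ε, hε, h⟩
  obtain ⟨ε, hε, hεe⟩ := hmin
  refine ⟨ε, hε, fun F => ?_⟩
  set T := ∑ j ∈ Finset.range (i + 1), wt a (i + 1) j *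
    Hpart (μ.map (chainMap X π j)) (fun x => fun g : F => p j ((X j).act g x))
  have key : ∀ s, wP X π a (fun _ => 0) F ε i Set.univ < s → T - F.card * c ≤ Real.log s := by
    intro s hs
    obtain ⟨κ, _, D, hDm, hDd, hDν⟩ := exists_partitions X π hε i ha _ s hs
    have h1 := hDν μ this (by simp)
    have h2 : T ≤ ∑ j ∈ Finset.range (i + 1), wt a (i + 1) j * (Hpart μ (D j) + F.card * c) := by
      refine Finset.sum_le_sum fun j hj => mul_le_mul_of_nonneg_left ?_
        (wt_nonneg ha (Finset.mem_range.1 hj))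
      have hpm : ∀ b, MeasurableSet
          ((fun x => fun g : F => p j ((X j).act g x)) ⁻¹' {b}) :=
        measurableSet_preimage_pi fun (g : F) b =>
          measurableSet_preimage_act (X j) (fun b => hp j (measurableSet_singleton b)) g b
      rw [Hpart_map μ (hm j) hpm]
      exact he j μ (hm j) rfl F (hDm j) fun x y hxy =>
        (hDd j (Nat.lt_succ_iff.1 (Finset.mem_range.1 hj)) x y trivial trivial hxy).trans_le
          (hεe j hj)
    simp only [mul_add, Finset.sum_add_distrib, ← Finset.sum_mul, sum_wt, one_mul] at h2
    linarith
  have hexp : Real.exp (T - F.card * c) ≤ wP X π a (fun _ => 0) F ε i Set.univ := by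
    refine le_of_forall_gt_imp_ge_of_dense fun s hs => ?_
    exact (Real.le_log_iff_exp_le ((wP_nonneg X π a _ F ε i _).trans_lt hs)).1 (key s hs)
  have := (Real.le_log_iff_exp_le ((Real.exp_pos _).trans_le hexp)).2 hexp
  linarith

lemma sum_wt_mul_hSeq_le_press {Fn : ℕ → Finset G} (hFn : IsFolner G Fn) {a : ℕ → ℝ} (i : ℕ)
    (ha : ∀ j < i, a j ∈ Set.Icc (0 : ℝ) 1)
    {μ : Measure (X 0).carrier} (hμ : IsInvProb (X 0) μ) {p : ∀ j, (X j).carrier → ℕ}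
    (hp : ∀ j, Measurable (p j)) (hfin : ∀ j, (Set.range (p j)).Finite) :
    ((∑ j ∈ Finset.range (i + 1), wt a (i + 1) j *
        hSeq (X j) Fn (μ.map (chainMap X π j)) (p j) : ℝ) : EReal)
      ≤ press X π (i + 1) a (fun _ => 0) Fn := by
  set A := ∑ j ∈ Finset.range (i + 1), wt a (i + 1) j *
        hSeq (X j) Fn (μ.map (chainMap X π j)) (p j) with hA
  have hlim : Tendsto (fun n => ∑ j ∈ Finset.range (i + 1), wt a (i + 1) j *
      (Hpart (μ.map (chainMap X π j)) (fun x => fun g : Fn n => p j ((X j).act g x))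
        / (Fn n).card)) atTop (nhds A) :=
    tendsto_finsetSum _ fun j _ => (tendsto_hSeq (X j) hFn (isInvProb_map_chainMap X π hμ j)
      (hp j) (hfin j)).const_mul _
  have hle : ∀ c > 0, ((A - c : ℝ) : EReal) ≤ press X π (i + 1) a (fun _ => 0) Fn := by
    intro c hc
    obtain ⟨ε, hε, h⟩ := exists_eps_sum_wt_mul_Hpart_le X π i ha hμ hp hfin hc
    refine le_trans ?_ (le_iSup₂_of_le (f := fun ε (_ : 0 < ε) =>
      pressEps X π (i + 1) a (fun _ => 0) Fn ε) ε hε le_rfl)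
    have hlim' : Tendsto (fun n => ((∑ j ∈ Finset.range (i + 1), wt a (i + 1) j *
      (Hpart (μ.map (chainMap X π j)) (fun x => fun g : Fn n => p j ((X j).act g x))
        / (Fn n).card) - c : ℝ) : EReal)) atTop (nhds ((A - c : ℝ) : EReal)) :=
      (continuous_coe_real_ereal.tendsto _).comp (hlim.sub_const c)
    rw [← hlim'.limsup_eq]
    refine limsup_le_limsup (.of_forall fun n => ?_)
    have hn : (0 : ℝ) < (Fn n).card := by exact_mod_cast (hFn.1 n).card_pos
    refine EReal.coe_le_coe_iff.2 ?_
    rw [le_div_iff₀ hn]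
    have h1 := h (Fn n)
    have h2 : (∑ j ∈ Finset.range (i + 1), wt a (i + 1) j *
        (Hpart (μ.map (chainMap X π j)) (fun x => fun g : Fn n => p j ((X j).act g x))
          / (Fn n).card)) * (Fn n).card = ∑ j ∈ Finset.range (i + 1), wt a (i + 1) j *
        Hpart (μ.map (chainMap X π j)) (fun x => fun g : Fn n => p j ((X j).act g x)) := by
      rw [Finset.sum_mul]
      refine Finset.sum_congr rfl fun j _ => ?_
      field_simp
    rw [sub_mul, h2, Nat.add_sub_cancel]
    linarith
  by_contra hlt
  obtain ⟨z, hz1, hz2⟩ := EReal.lt_iff_exists_real_btwn.1 (not_le.1 hlt)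
  have := hle (A - z) (sub_pos.2 (EReal.coe_lt_coe_iff.1 hz2))
  rw [sub_sub_cancel] at this
  exact absurd hz1 (not_lt.2 this)

lemma coe_mul_iSup_le {T : Type*} [Nonempty T] {w : ℝ} (hw : 0 ≤ w) {h : T → ℝ} {B : EReal}
    (hB : ∀ t, ((w * h t : ℝ) : EReal) ≤ B) : (w : EReal) * ⨆ t, (h t : EReal) ≤ B := by
  rcases hw.eq_or_lt with rfl | hw
  · simpa using hB (Classical.arbitrary T)
  · have hw' : (0 : EReal) < w := by exact_mod_cast hw
    rw [mul_comm, ← EReal.le_div_iff_mul_le hw' (EReal.coe_ne_top _)]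
    refine iSup_le fun t => ?_
    rw [EReal.le_div_iff_mul_le hw' (EReal.coe_ne_top _), mul_comm]
    exact_mod_cast hB t

lemma sum_coe_mul_iSup_le {α : Type*} {T : α → Type*} [∀ i, Nonempty (T i)] (s : Finset α)
    {w : α → ℝ} (hw : ∀ i ∈ s, 0 ≤ w i) {h : ∀ i, T i → ℝ} (hh : ∀ i t, 0 ≤ h i t) {B : EReal}
    (hB : ∀ t : ∀ i, T i, ((∑ i ∈ s, w i * h i (t i) : ℝ) : EReal) ≤ B) :
    ∑ i ∈ s, (w i : EReal) * ⨆ t, (h i t : EReal) ≤ B := by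
  classical
  induction s using Finset.induction_on generalizing B with
  | empty => simpa using hB fun i => Classical.arbitrary _
  | insert i s hi ih =>
    rw [Finset.sum_insert hi]
    set Z := ∑ j ∈ s, (w j : EReal) * ⨆ t, (h j t : EReal) with hZ
    have hws : ∀ j ∈ s, 0 ≤ w j := fun j hj => hw j (Finset.mem_insert_of_mem hj)
    have hZ0 : 0 ≤ Z := Finset.sum_nonneg fun j hj => mul_nonneg (by exact_mod_cast hws j hj)
      (le_iSup_of_le (Classical.arbitrary _) (by exact_mod_cast hh j _))
    have hZB : ∀ t, ((w i * h i t : ℝ) : EReal) + Z ≤ B := by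
      intro t
      rw [add_comm]
      refine EReal.add_le_of_le_sub (ih hws fun t' => ?_)
      rw [EReal.le_sub_iff_add_le (.inl (EReal.coe_ne_bot _)) (.inl (EReal.coe_ne_top _)),
        ← EReal.coe_add]
      have := hB (Function.update t' i t)
      rw [Finset.sum_insert hi, Function.update_self, add_comm] at this
      rwa [Finset.sum_congr rfl fun j hj => by
        rw [Function.update_of_ne (ne_of_mem_of_not_mem hj hi)]] at this
    have hZbot : Z ≠ ⊥ := (EReal.bot_lt_zero.trans_le hZ0).ne'
    by_cases hZtop : Z = ⊤
    · have := hZB (Classical.arbitrary _)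
      rw [hZtop, EReal.coe_add_top, top_le_iff] at this
      rw [this]
      exact le_top
    · rw [← EReal.le_sub_iff_add_le (.inl hZbot) (.inl hZtop)]
      refine coe_mul_iSup_le (hw i (Finset.mem_insert_self _ _)) fun t => ?_
      rw [EReal.le_sub_iff_add_le (.inl hZbot) (.inl hZtop)]
      exact hZB t

end LowerBound

end WPP

open WPP in
/-- **Lower bound half of the variational principle for weighted entropy** (Corollary 3.2):
`sup_{μ ∈ M^G(X_1)} Σ_{i=1}^r w_i h_{μ_i}(X_i,G) ≤ h^a_top(G)`, where
`h^a_top(G) = P^a(0,G)`. -/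
theorem weighted_entropy_lower_bound
    {G : Type} [Group G] [Countable G] [Infinite G]
    (Fn : ℕ → Finset G) (hFn : IsFolner G Fn)
    (X : ℕ → GSystem G) (π : ∀ i, FactorMap (X i) (X (i + 1)))
    (r : ℕ) (hr : 2 ≤ r) (a : ℕ → ℝ) (ha : ∀ i < r - 1, a i ∈ Set.Icc (0 : ℝ) 1) :
    (⨆ μ : {μ : MeasureTheory.Measure (X 0).carrier // IsInvProb (X 0) μ},
        ∑ i ∈ Finset.range r,
          ((wt a r i : ℝ) : EReal) * mEnt (X i) Fn (μ.1.map (chainMap X π i)))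
      ≤ press X π r a (fun _ => 0) Fn := by
  obtain ⟨i, rfl⟩ : ∃ i, r = i + 1 := ⟨r - 1, by lia⟩
  refine iSup_le fun ⟨μ, hμ⟩ => ?_
  have : ∀ j, Nonempty {p : (X j).carrier → ℕ // Measurable p ∧ (Set.range p).Finite} :=
    fun j => ⟨fun _ => 0, measurable_const, Set.finite_range_const⟩
  refine sum_coe_mul_iSup_le _ (fun j hj => wt_nonneg ha (Finset.mem_range.1 hj))
    (h := fun j (p : {p : (X j).carrier → ℕ // Measurable p ∧ (Set.range p).Finite}) =>
      hSeq (X j) Fn (μ.map (chainMap X π j)) p.1) (fun j p => ?_) fun p => ?_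
  · have hinv := isInvProb_map_chainMap X π hμ j
    have := hinv.1
    exact ge_of_tendsto' (tendsto_hSeq (X j) hFn hinv p.2.1 p.2.2)
      fun n => div_nonneg (Hpart_nonneg _ _) (Nat.cast_nonneg _)
  · exact sum_wt_mul_hSeq_le_press X π hFn i ha hμ (fun j => (p j).2.1) fun j => (p j).2.2
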